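/- arXiv:2506.00962 — 3 statements merged into one kernel-verified Lean document; each statement's English description precedes it below -/
import Mathlib

section
/- State-space expected return (Proposition 3.3): Let (Ω, ℱ, P) be a probability space, 𝒮 and 𝒜 measurable spaces, S : ℕ → Ω → 𝒮 and A : ℕ → Ω → 𝒜 sequences of measurable maps, and N : Ω → ℕ a measurable map with ∫⁻_Ω (N ω + 1) dP < ∞. Let η := ∑_{n=0}^∞ (push-forward under ω ↦ (S n ω, A n ω) of the restriction of P to {ω | n ≤ N ω}) be the occupation measure on 𝒮 × 𝒜. Then η(𝒮 × 𝒜) = ∫⁻_Ω (N ω + 1) dP, this quantity lies in (0, ∞), the normalized measure ρ := (η(𝒮 × 𝒜))⁻¹ • η is a probability measure, and for every measurable r : 𝒮 × 𝒜 → [0,∞] the expected return factorizes as ∫⁻_Ω (∑_{n=0}^{N ω} r(S n ω, A n ω)) dP = (∫⁻_Ω (N ω + 1) dP) · ∫⁻_{𝒮×𝒜} r dρ, i.e. J = E[N+1] · E_{(s,a) ∼ ρ}[r(s,a)]. -/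
open MeasureTheory
open scoped ENNReal

/-- State-space expected return: if `E[N+1] < ∞`, the occupation measure `η`
has total mass `E[N+1] ∈ (0,∞)`, its normalization `ρ` is a probability
measure, and the expected return factorizes as
`J = E[N+1] · E_{(s,a) ∼ ρ}[r(s,a)]`. -/
theorem expected_return_eq_horizon_mul_state_space_average
    {Ω : Type*} [MeasurableSpace Ω] (P : Measure Ω) [IsProbabilityMeasure P]
    {𝒮 𝒜 : Type*} [MeasurableSpace 𝒮] [MeasurableSpace 𝒜]
    (S : ℕ → Ω → 𝒮) (hS : ∀ n, Measurable (S n))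
    (A : ℕ → Ω → 𝒜) (hA : ∀ n, Measurable (A n))
    (N : Ω → ℕ) (hN : Measurable N)
    (hfin : ∫⁻ ω, ((N ω : ℝ≥0∞) + 1) ∂P < ∞)
    (η : Measure (𝒮 × 𝒜))
    (hη : η = Measure.sum (fun n : ℕ =>
      Measure.map (fun ω => (S n ω, A n ω)) (P.restrict {ω | n ≤ N ω}))) :
    η Set.univ = ∫⁻ ω, ((N ω : ℝ≥0∞) + 1) ∂P
      ∧ 0 < η Set.univ ∧ η Set.univ < ∞
      ∧ IsProbabilityMeasure ((η Set.univ)⁻¹ • η)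
      ∧ ∀ r : 𝒮 × 𝒜 → ℝ≥0∞, Measurable r →
          ∫⁻ ω, ∑ n ∈ Finset.range (N ω + 1), r (S n ω, A n ω) ∂P
            = (∫⁻ ω, ((N ω : ℝ≥0∞) + 1) ∂P)
              * ∫⁻ x, r x ∂((η Set.univ)⁻¹ • η) := by
  have key : ∀ r : 𝒮 × 𝒜 → ℝ≥0∞, Measurable r →
      ∫⁻ ω, ∑ n ∈ Finset.range (N ω + 1), r (S n ω, A n ω) ∂P = ∫⁻ x, r x ∂η := by
    intro r hr
    have hm : ∀ n, MeasurableSet {ω | n ≤ N ω} := fun n => measurableSet_le measurable_const hN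
    have hrm : ∀ n, Measurable fun ω => r (S n ω, A n ω) :=
      fun n => hr.comp ((hS n).prodMk (hA n))
    rw [hη, lintegral_sum_measure]
    have h1 : ∀ n, ∫⁻ x, r x ∂(Measure.map (fun ω => (S n ω, A n ω)) (P.restrict {ω | n ≤ N ω}))
        = ∫⁻ ω, {ω | n ≤ N ω}.indicator (fun ω => r (S n ω, A n ω)) ω ∂P := by
      intro n
      rw [lintegral_map hr ((hS n).prodMk (hA n)), lintegral_indicator (hm n)]
    simp_rw [h1]
    rw [← lintegral_tsum (fun n => ((hrm n).indicator (hm n)).aemeasurable)]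
    refine lintegral_congr fun ω => ?_
    rw [tsum_eq_sum (s := Finset.range (N ω + 1))]
    · refine Finset.sum_congr rfl fun n hn => ?_
      have h : n ≤ N ω := Nat.lt_succ_iff.mp (Finset.mem_range.mp hn)
      rw [Set.indicator_of_mem (show ω ∈ {ω | n ≤ N ω} from h)]
    · intro n hn
      have hnot : ω ∉ {ω | n ≤ N ω} :=
        fun h => hn (Finset.mem_range.mpr (Nat.lt_succ_iff.mpr h))
      rw [Set.indicator_of_notMem hnot]
  have hmass : η Set.univ = ∫⁻ ω, ((N ω : ℝ≥0∞) + 1) ∂P := by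
    have h := key (fun _ => 1) measurable_const
    simpa using h.symm
  have hpos : 0 < η Set.univ := by
    rw [hmass]
    calc (0 : ℝ≥0∞) < 1 := one_pos
      _ = ∫⁻ _, 1 ∂P := by simp
      _ ≤ _ := lintegral_mono fun ω => le_add_self
  have hlt : η Set.univ < ∞ := hmass ▸ hfin
  refine ⟨hmass, hpos, hlt, ⟨?_⟩, ?_⟩
  · rw [Measure.smul_apply, smul_eq_mul, ENNReal.inv_mul_cancel hpos.ne' hlt.ne]
  · intro r hr
    rw [key r hr, ← hmass, lintegral_smul_measure, smul_eq_mul, ← mul_assoc,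
      ENNReal.mul_inv_cancel hpos.ne' hlt.ne, one_mul]
end

section
/- Baseline invariance of the policy gradient (core of Corollary 3.5, equation (19c)): Let (X, μ) be a measure space, θ₀ ∈ ℝ, ε > 0, and p, p' : ℝ → X → ℝ satisfying: for every θ in the open ball of radius ε around θ₀, x ↦ p θ x is a.e.-strongly measurable, μ-integrable, with ∫ p θ x dμ(x) = 1; for μ-a.e. x and every θ in the ball, θ ↦ p θ x has derivative p' θ x at θ; there is a μ-integrable g with |p' θ x| ≤ g x for μ-a.e. x and all θ in the ball; and p θ₀ x > 0 for μ-a.e. x. Then for every bounded measurable f : X → ℝ and every constant c ∈ ℝ, ∫ (f x − c) · (d/dθ log p θ x)|_{θ=θ₀} · p θ₀ x dμ(x) = ∫ f x · (d/dθ log p θ x)|_{θ=θ₀} · p θ₀ x dμ(x), i.e. subtracting an arbitrary baseline from the Q-value weighting does not change the policy gradient. -/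
open MeasureTheory

/-- Baseline invariance of the policy gradient: subtracting an arbitrary
constant baseline `c` from the weighting `f` does not change the
score-function integral. -/
theorem integral_baseline_invariance
    {X : Type*} [MeasurableSpace X] (μ : Measure X)
    (θ₀ : ℝ) (ε : ℝ) (hε : 0 < ε) (p p' : ℝ → X → ℝ)
    (hmeas : ∀ θ ∈ Metric.ball θ₀ ε, AEStronglyMeasurable (p θ) μ)
    (hint : ∀ θ ∈ Metric.ball θ₀ ε, Integrable (p θ) μ)
    (hdensity : ∀ θ ∈ Metric.ball θ₀ ε, ∫ x, p θ x ∂μ = 1)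
    (hderiv : ∀ᵐ x ∂μ, ∀ θ ∈ Metric.ball θ₀ ε,
      HasDerivAt (fun θ => p θ x) (p' θ x) θ)
    (g : X → ℝ) (hg : Integrable g μ)
    (hbound : ∀ᵐ x ∂μ, ∀ θ ∈ Metric.ball θ₀ ε, |p' θ x| ≤ g x)
    (hpos : ∀ᵐ x ∂μ, 0 < p θ₀ x)
    (f : X → ℝ) (hf : Measurable f) (hfbdd : ∃ C, ∀ x, |f x| ≤ C) (c : ℝ) :
    ∫ x, (f x - c) * (p' θ₀ x / p θ₀ x) * p θ₀ x ∂μ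
      = ∫ x, f x * (p' θ₀ x / p θ₀ x) * p θ₀ x ∂μ := by
  have h0 : θ₀ ∈ Metric.ball θ₀ ε := Metric.mem_ball_self hε
  have hball : Metric.ball θ₀ ε ∈ nhds θ₀ := Metric.ball_mem_nhds _ hε
  have hm' : AEStronglyMeasurable (p' θ₀) μ := by
    have ht : Filter.Tendsto (fun n : ℕ => ε / 2 * (1 / ((n : ℝ) + 1))) Filter.atTop
        (nhdsWithin 0 {0}ᶜ) := by
      refine tendsto_nhdsWithin_iff.2 ⟨?_, Filter.Eventually.of_forall fun n => ?_⟩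
      · simpa using (tendsto_one_div_add_atTop_nhds_zero_nat (𝕜 := ℝ)).const_mul (ε / 2)
      · have : 0 < ε / 2 * (1 / ((n : ℝ) + 1)) := by positivity
        exact this.ne'
    refine aestronglyMeasurable_of_tendsto_ae Filter.atTop
      (f := fun (n : ℕ) x => (ε / 2 * (1 / ((n : ℝ) + 1)))⁻¹ •
        (p (θ₀ + ε / 2 * (1 / ((n : ℝ) + 1))) x - p θ₀ x)) (fun n => ?_) ?_
    · refine ((hmeas _ ?_).sub (hmeas _ h0)).const_smul (ε / 2 * (1 / ((n : ℝ) + 1)))⁻¹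
      have hpos' : 0 < ε / 2 * (1 / ((n : ℝ) + 1)) := by positivity
      have hle : 1 / ((n : ℝ) + 1) ≤ 1 := by
        rw [div_le_one (by positivity)]
        have : (0 : ℝ) ≤ n := Nat.cast_nonneg n
        linarith
      rw [Metric.mem_ball, Real.dist_eq, add_sub_cancel_left, abs_of_pos hpos']
      nlinarith
    · filter_upwards [hderiv] with x hx
      exact (hx θ₀ h0).tendsto_slope_zero.comp ht
  obtain ⟨hi, hd⟩ := hasDerivAt_integral_of_dominated_loc_of_deriv_le hball
    (Filter.eventually_of_mem hball hmeas) (hint _ h0) hm' hbound hg hderiv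
  have hz : ∫ x, p' θ₀ x ∂μ = 0 := by
    refine hd.unique ((hasDerivAt_const θ₀ (1 : ℝ)).congr_of_eventuallyEq ?_)
    exact Filter.eventually_of_mem hball hdensity
  obtain ⟨C, hC⟩ := hfbdd
  have hfi : Integrable (fun x => f x * p' θ₀ x) μ :=
    hi.bdd_mul hf.aestronglyMeasurable (Filter.Eventually.of_forall hC)
  have e1 : ∫ x, (f x - c) * (p' θ₀ x / p θ₀ x) * p θ₀ x ∂μ
      = ∫ x, (f x * p' θ₀ x - c * p' θ₀ x) ∂μ := by
    refine integral_congr_ae ?_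
    filter_upwards [hpos] with x hx
    have := hx.ne'
    field_simp
  have e2 : ∫ x, f x * (p' θ₀ x / p θ₀ x) * p θ₀ x ∂μ = ∫ x, f x * p' θ₀ x ∂μ := by
    refine integral_congr_ae ?_
    filter_upwards [hpos] with x hx
    have := hx.ne'
    field_simp
  rw [e1, e2, integral_sub hfi (hi.const_mul c), integral_const_mul, hz]
  simp
end

section
/- Model-based gradient of the Q-value function with respect to the action (core of Corollary 3.8, equation (C.27)): Let (𝒮', μ) be a measure space, V : 𝒮' → ℝ a bounded measurable function (the value function), r : ℝ → ℝ a function differentiable at a₀ ∈ ℝ with derivative r'(a₀), ε > 0, and p, p' : ℝ → 𝒮' → ℝ (the transition density and its action-derivative) such that: for every a in the open ball of radius ε around a₀, s' ↦ V s' · p a s' is a.e.-strongly measurable and s' ↦ V s' · p a₀ s' is μ-integrable; for μ-a.e. s' and every a in the ball, a ↦ p a s' has derivative p' a s' at a; there is a μ-integrable g with |V s' · p' a s'| ≤ g s' for μ-a.e. s' and all a in the ball; and p a₀ s' > 0 for μ-a.e. s'. Define Q(a) := r(a) + ∫ p a s' · V s' dμ(s'). Then Q is differentiable at a₀ with derivative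 Q'(a₀) = r'(a₀) + ∫ (d/da log p a s')|_{a=a₀} · p a₀ s' · V s' dμ(s'). -/
open MeasureTheory

/-- Model-based gradient of the Q-value function with respect to the action:
for `Q(a) = r(a) + ∫ p(a,s') V(s') dμ(s')`, under dominated-differentiability
conditions, `Q'(a₀) = r'(a₀) + ∫ (∇_a log p(a,s'))|_{a₀} p(a₀,s') V(s') dμ(s')`. -/
theorem hasDerivAt_Q_value_model_based
    {𝒮' : Type*} [MeasurableSpace 𝒮'] (μ : Measure 𝒮')
    (V : 𝒮' → ℝ) (hV : Measurable V) (hVbdd : ∃ C, ∀ s', |V s'| ≤ C)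
    (r : ℝ → ℝ) (a₀ : ℝ) (r' : ℝ) (hr : HasDerivAt r r' a₀)
    (ε : ℝ) (hε : 0 < ε) (p p' : ℝ → 𝒮' → ℝ)
    (hmeas : ∀ a ∈ Metric.ball a₀ ε,
      AEStronglyMeasurable (fun s' => V s' * p a s') μ)
    (hint : Integrable (fun s' => V s' * p a₀ s') μ)
    (hderiv : ∀ᵐ s' ∂μ, ∀ a ∈ Metric.ball a₀ ε,
      HasDerivAt (fun a => p a s') (p' a s') a)
    (g : 𝒮' → ℝ) (hg : Integrable g μ)
    (hbound : ∀ᵐ s' ∂μ, ∀ a ∈ Metric.ball a₀ ε, |V s' * p' a s'| ≤ g s')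
    (hpos : ∀ᵐ s' ∂μ, 0 < p a₀ s') :
    HasDerivAt (fun a => r a + ∫ s', p a s' * V s' ∂μ)
      (r' + ∫ s', (p' a₀ s' / p a₀ s') * p a₀ s' * V s' ∂μ) a₀ := by
  have hd : ∀ᵐ s' ∂μ, ∀ a ∈ Metric.ball a₀ ε,
      HasDerivAt (fun a => V s' * p a s') (V s' * p' a s') a := by
    filter_upwards [hderiv] with s hs a ha
    exact (hs a ha).const_mul (V s)
  have ha₀ : a₀ ∈ Metric.ball a₀ ε := Metric.mem_ball_self hε
  let u : ℕ → ℝ := fun n => a₀ + (ε / 2) * (1 / ((n : ℝ) + 1))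
  have hu0 : ∀ n : ℕ, 0 < (ε / 2) * (1 / ((n : ℝ) + 1)) := fun n => mul_pos (half_pos hε) Nat.one_div_pos_of_nat
  have hub : ∀ n, u n ∈ Metric.ball a₀ ε := by
    intro n
    have h1 : 1 / ((n : ℝ) + 1) ≤ 1 := by
      rw [div_le_one (by positivity)]
      linarith [(Nat.cast_nonneg n : (0 : ℝ) ≤ n)]
    rw [Metric.mem_ball, Real.dist_eq, show u n - a₀ = (ε / 2) * (1 / ((n : ℝ) + 1)) by
      simp only [u]; ring, abs_of_pos (hu0 n)]
    nlinarith
  have hut : Filter.Tendsto u Filter.atTop (nhdsWithin a₀ {a₀}ᶜ) := by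
    refine tendsto_nhdsWithin_iff.2 ⟨?_, Filter.Eventually.of_forall fun n => ?_⟩
    · have := ((tendsto_one_div_add_atTop_nhds_zero_nat (𝕜 := ℝ)).const_mul (ε / 2)).const_add a₀
      simpa [u] using this
    · have := hu0 n
      simp only [Set.mem_compl_iff, Set.mem_singleton_iff, u]
      intro h
      linarith
  have hF' : AEStronglyMeasurable (fun s' => V s' * p' a₀ s') μ := by
    refine aestronglyMeasurable_of_tendsto_ae Filter.atTop
      (f := fun n s' => (u n - a₀)⁻¹ * (V s' * p (u n) s' - V s' * p a₀ s')) (fun n => ?_) ?_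
    · exact ((hmeas _ (hub n)).sub (hmeas _ ha₀)).const_mul _
    · filter_upwards [hd] with s hs
      exact (hasDerivAt_iff_tendsto_slope.1 (hs a₀ ha₀)).comp hut
  have key := (hasDerivAt_integral_of_dominated_loc_of_deriv_le (μ := μ)
    (F := fun a s' => V s' * p a s') (F' := fun a s' => V s' * p' a s')
    (Metric.ball_mem_nhds a₀ hε)
    (Filter.eventually_of_mem (Metric.ball_mem_nhds a₀ hε) hmeas) hint hF' hbound hg hd).2
  have e1 : ∫ s', (p' a₀ s' / p a₀ s') * p a₀ s' * V s' ∂μ = ∫ s', V s' * p' a₀ s' ∂μ := by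
    refine integral_congr_ae ?_
    filter_upwards [hpos] with s hs
    rw [div_mul_cancel₀ _ hs.ne', mul_comm]
  rw [e1]
  simp_rw [fun a s' => mul_comm (p a s') (V s')]
  exact hr.add key
end
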